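/- Fix an odd prime p. Then the p^{(0)}-Fibonacci numbers satisfy M(λ(2;(x_{(2,0)}, x_{(1,0)}))) = (p−1)/2, and for every s ≥ 2, M(λ(2s;(x_{(2s,0)}, x_{(s,0)}))) = ((p−1)/2)·(2(s−1)p^{s−1} − (2s−3)p^{s−2}). -/

import Mathlib

open Finset

namespace Bratteli

/-- `x_{(a,k)} = p^k (a·p - (a+1))` (the labels of the vertices of the p-Bratteli diagram). -/
def xv (p a k : ℕ) : ℕ := p ^ k * (a * p - (a + 1))

/-- `j^k_t = t · ∑_{i<k} p^i`. -/
def jkt (p k t : ℕ) : ℕ := t * ∑ i ∈ range k, p ^ i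

/-- base-`p` digits of `N`: a path of shape `λ(2r;(x_{(2s,k)},x_{(s,k)}+l))` is encoded by the
digit tuple `(t_0, …, t_{r-1})` of a number `N < p^r`. -/
def tDig (p N : ℕ) : ℕ → ℕ := fun i => N / p ^ i % p

/-- `α_j = ∑_{i=j}^{k+j-2} p^{i-j} t_i`. -/
def alphaF (p k : ℕ) (t : ℕ → ℕ) (j : ℕ) : ℕ := ∑ d ∈ range (k - 1), p ^ d * t (j + d)

/-- `i_j = ∑_{i=r-j}^{r-1} p^{i-(r-j)} t_i`. -/
def iIdx (p r : ℕ) (t : ℕ → ℕ) (j : ℕ) : ℕ := ∑ d ∈ range j, p ^ d * t (r - j + d)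

/-- vertical part `n_i` of the `i`-th block of the path encoded by `t`. -/
def nB (p k r : ℕ) (t : ℕ → ℕ) (i : ℕ) : ℕ :=
  if i % 2 = 1 then
    -- odd blocks `i = 2j+1`
    if i / 2 < k then 0 else p ^ k * (p - 1 - t (k + r - i / 2 - 1))
  else
    -- even blocks `i = 2j`
    if i / 2 ≤ k then (p - 1) * iIdx p r t (i / 2) + t (r - i / 2 - 1)
    else if k = 0 then t (r - i / 2 - 1)
    else (p - 1) * (alphaF p k t (r - i / 2) + p ^ (k - 1) * t (k + r - i / 2 - 1))
      + t (r - i / 2 - 1)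

/-- horizontal part `m_i` of the `i`-th block of the path encoded by `t`. -/
def mB (p k r : ℕ) (t : ℕ → ℕ) (i : ℕ) : ℕ :=
  if i % 2 = 1 then
    -- odd blocks `i = 2j+1`
    if i / 2 < k then 0 else p ^ k * t (k + r - i / 2 - 1)
  else
    -- even blocks `i = 2j`
    if i / 2 ≤ k then p ^ (k - 1) * (p - 1) ^ 2 - nB p k r t i
    else if k = 0 then p - 1 - t (r - i / 2 - 1)
    else p ^ k * (p - 1) - nB p k r t (i - 1)

/-- The path encoded by `t` has a descent at block `i`: at block `2k` exactly when
`t_{r-1} < (p-1)/2` (convention (c1)), and at a block `2k+2 ≤ i ≤ 2r-2` exactly when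
`m_i > m_{i+1}`; there is never a descent at block `2k+1` or below block `2k`. -/
def HasDescent (p k r : ℕ) (t : ℕ → ℕ) (i : ℕ) : Prop :=
  (i = 2 * k ∧ t (r - 1) < (p - 1) / 2) ∨
    (2 * k + 2 ≤ i ∧ i ≤ 2 * r - 2 ∧ mB p k r t (i + 1) < mB p k r t i)

instance (p k r : ℕ) (t : ℕ → ℕ) : DecidablePred (HasDescent p k r t) := fun i => by
  unfold HasDescent; infer_instance

/-- `des(P)`: the number of descents of the path encoded by `t`. -/
def desNum (p k r : ℕ) (t : ℕ → ℕ) : ℕ :=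
  ((range (2 * r - 1)).filter (HasDescent p k r t)).card

/-- `inv(P)`: the number of inversions of the path encoded by `t`; pairs `(i,j)` with
`2k+2 ≤ i < j ≤ 2r-1`, `m_i + n_i = m_j + n_j`, `m_i > m_j`, `n_i < n_j`, plus `1` exactly
when `t_{r-1} < (p-1)/2` (convention (c1) at block `2k`). -/
def invNum (p k r : ℕ) (t : ℕ → ℕ) : ℕ :=
  ((range (2 * r) ×ˢ range (2 * r)).filter fun q : ℕ × ℕ =>
      2 * k + 2 ≤ q.1 ∧ q.1 < q.2 ∧
        mB p k r t q.1 + nB p k r t q.1 = mB p k r t q.2 + nB p k r t q.2 ∧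
        mB p k r t q.2 < mB p k r t q.1 ∧ nB p k r t q.1 < nB p k r t q.2).card +
    if t (r - 1) < (p - 1) / 2 then 1 else 0

/-- `t` encodes a path of shape `λ(2r;(x_{(2s,k)},x_{(s,k)}+l))`. -/
def IsPath (p k r l : ℕ) (t : ℕ → ℕ) : Prop :=
  (∀ i, i ≤ r - 2 → t i ≤ p - 1) ∧ t (r - 1) ≤ p - 2 ∧ l = ∑ i ∈ range k, p ^ i * t i

/-- the finite set of all paths of shape `λ(2r;(x_{(2s,k)},x_{(s,k)}+l))`, encoded as the
numbers `N < p^r` whose base-`p` digits give the tuples `(t_0,…,t_{r-1})`. -/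
def pathFinset (p k r l : ℕ) : Finset ℕ :=
  (range (p ^ r)).filter fun N =>
    tDig p N (r - 1) ≤ p - 2 ∧ l = ∑ i ∈ range k, p ^ i * tDig p N i

/-- the `p^{(k)}`-Fibonacci number `𝓜(λ(2r;(x_{(2s,k)},x_{(s,k)}+l)))`:
the total number of descents over all paths of this shape. -/
def Mnum (p k r l : ℕ) : ℕ := ∑ N ∈ pathFinset p k r l, desNum p k r (tDig p N)

theorem tDig_zero_add_mul {p c : ℕ} (hc : c < p) (N : ℕ) : tDig p (c + p * N) 0 = c := by
  simp [tDig, Nat.add_mul_mod_self_left, Nat.mod_eq_of_lt hc]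

theorem tDig_succ_add_mul {p c : ℕ} (hc : c < p) (N i : ℕ) :
    tDig p (c + p * N) (i + 1) = tDig p N i := by
  have hp : 0 < p := by omega
  simp only [tDig]
  rw [pow_succ', ← Nat.div_div_eq_div_mul, Nat.add_mul_div_left _ _ hp,
    Nat.div_eq_of_lt hc, zero_add]

theorem tDig_lt {p : ℕ} (hp : 0 < p) (N i : ℕ) : tDig p N i < p := Nat.mod_lt _ hp

theorem mem_pathFinset_zero {p r N : ℕ} :
    N ∈ pathFinset p 0 r 0 ↔ N < p ^ r ∧ tDig p N (r - 1) ≤ p - 2 := by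
  simp [pathFinset]

/-- Summation over paths, splitting off the lowest digit. -/
theorem sum_pathFinset_succ {p r : ℕ} (hp : 0 < p) (hr : 1 ≤ r) (f : ℕ → ℕ) :
    ∑ N ∈ pathFinset p 0 (r + 1) 0, f N =
      ∑ N ∈ pathFinset p 0 r 0, ∑ c ∈ range p, f (c + p * N) := by
  obtain ⟨r, rfl⟩ : ∃ q, r = q + 1 := ⟨r - 1, by omega⟩
  rw [← sum_product']
  symm
  refine sum_nbij' (fun x => x.2 + p * x.1) (fun N => (N / p, N % p)) ?_ ?_ ?_ ?_ ?_
  · rintro ⟨N, c⟩ h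
    simp only [mem_product, mem_pathFinset_zero, mem_range, Nat.add_sub_cancel] at h ⊢
    obtain ⟨⟨hN, ht⟩, hc⟩ := h
    refine ⟨?_, by rwa [tDig_succ_add_mul hc]⟩
    calc c + p * N < p * (N + 1) := by rw [mul_add]; omega
      _ ≤ p * p ^ (r + 1) := Nat.mul_le_mul_left _ hN
      _ = p ^ (r + 1 + 1) := (pow_succ' _ _).symm
  · intro N h
    simp only [mem_product, mem_pathFinset_zero, mem_range, Nat.add_sub_cancel] at h ⊢
    refine ⟨⟨?_, ?_⟩, Nat.mod_lt _ hp⟩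
    · apply Nat.div_lt_of_lt_mul
      rw [← pow_succ']
      exact h.1
    · have := tDig_succ_add_mul (Nat.mod_lt N hp) (N / p) r
      rw [Nat.mod_add_div] at this
      rw [← this]
      exact h.2
  · rintro ⟨N, c⟩ h
    simp only [mem_product, mem_range] at h
    simp [Nat.add_mul_div_left _ _ hp, Nat.div_eq_of_lt h.2, Nat.mod_eq_of_lt h.2]
  · intro N _
    exact Nat.mod_add_div N p
  · intros; rfl

theorem pathFinset_zero_one {p : ℕ} (hp : 2 ≤ p) : pathFinset p 0 1 0 = range (p - 1) := by
  ext N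
  simp only [mem_pathFinset_zero, mem_range, tDig, pow_one, Nat.sub_self, pow_zero, Nat.div_one]
  constructor
  · rintro ⟨h, h'⟩
    rw [Nat.mod_eq_of_lt h] at h'
    omega
  · intro h
    have h' : N < p := by omega
    rw [Nat.mod_eq_of_lt h']
    omega

theorem card_pathFinset_zero {p : ℕ} (hp : 2 ≤ p) (r : ℕ) :
    (pathFinset p 0 (r + 1) 0).card = (p - 1) * p ^ r := by
  induction r with
  | zero => simp [pathFinset_zero_one hp]
  | succ r ih =>
    rw [card_eq_sum_ones, sum_pathFinset_succ (by omega) (by omega)]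
    simp only [sum_const, card_range, smul_eq_mul, mul_one, ih]
    ring

theorem mB_zero_odd (p r : ℕ) (t : ℕ → ℕ) (j : ℕ) :
    mB p 0 r t (2 * j + 1) = t (r - j - 1) := by
  have h1 : (2 * j + 1) % 2 = 1 := by omega
  have h2 : (2 * j + 1) / 2 = j := by omega
  simp [mB, h1, h2]

theorem mB_zero_even (p r : ℕ) (t : ℕ → ℕ) {j : ℕ} (hj : 1 ≤ j) :
    mB p 0 r t (2 * j) = p - 1 - t (r - j - 1) := by
  have h2 : (2 * j) / 2 = j := by omega
  have h3 : ¬ j ≤ 0 := by omega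
  simp [mB, h2, h3]

theorem mB_zero_succ {p r i : ℕ} (t : ℕ → ℕ) (hi : 2 ≤ i) (hir : i + 1 ≤ 2 * r) :
    mB p 0 (r + 1) t i = mB p 0 r (fun j => t (j + 1)) i := by
  rcases Nat.even_or_odd' i with ⟨j, rfl | rfl⟩
  · rw [mB_zero_even _ _ _ (by omega), mB_zero_even _ _ _ (by omega)]
    congr 2
    omega
  · rw [mB_zero_odd, mB_zero_odd]
    congr 1
    omega

theorem hasDescent_zero_succ {p r i : ℕ} (t : ℕ → ℕ) (hr : 1 ≤ r) (hi : i < 2 * r - 1) :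
    HasDescent p 0 (r + 1) t i ↔ HasDescent p 0 r (fun j => t (j + 1)) i := by
  have h : r - 1 + 1 = r := by omega
  unfold HasDescent
  by_cases h2 : 2 ≤ i
  · rw [mB_zero_succ t h2 (by omega), mB_zero_succ t (by omega : 2 ≤ i + 1) (by omega)]
    simp only [Nat.add_sub_cancel, h]
    have h3 : i ≤ 2 * (r + 1) - 2 := by omega
    have h4 : i ≤ 2 * r - 2 := by omega
    simp [h3, h4]
  · simp [h2, h]

/-- Adding a lowest digit adds at most two new descents, at the blocks `2r - 1` and `2r`. -/
theorem desNum_zero_succ {p r : ℕ} (t : ℕ → ℕ) (hr : 1 ≤ r) :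
    desNum p 0 (r + 1) t = desNum p 0 r (fun j => t (j + 1)) +
      (if 2 ≤ r ∧ p - 1 - t 0 < t 1 then 1 else 0) + (if t 0 < p - 1 - t 0 then 1 else 0) := by
  obtain ⟨q, rfl⟩ : ∃ q, r = q + 1 := ⟨r - 1, by omega⟩
  have hlow : HasDescent p 0 (q + 1 + 1) t (2 * q + 1) ↔ 2 ≤ q + 1 ∧ p - 1 - t 0 < t 1 := by
    unfold HasDescent
    rw [show 2 * q + 1 + 1 = 2 * (q + 1) by ring, mB_zero_odd, mB_zero_even _ _ _ (by omega),
      show q + 1 + 1 - (q + 1) - 1 = 0 by omega, show q + 1 + 1 - q - 1 = 1 by omega]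
    omega
  have hhigh : HasDescent p 0 (q + 1 + 1) t (2 * q + 1 + 1) ↔ t 0 < p - 1 - t 0 := by
    unfold HasDescent
    rw [show 2 * q + 1 + 1 = 2 * (q + 1) by ring, mB_zero_odd, mB_zero_even _ _ _ (by omega),
      show q + 1 + 1 - (q + 1) - 1 = 0 by omega]
    omega
  unfold desNum
  rw [show 2 * (q + 1 + 1) - 1 = 2 * q + 1 + 1 + 1 by omega,
    show 2 * (q + 1) - 1 = 2 * q + 1 by omega]
  simp only [card_filter]
  rw [sum_range_succ, sum_range_succ]
  simp only [hlow, hhigh]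
  congr 2
  refine sum_congr rfl fun i hi => ?_
  rw [mem_range] at hi
  simp only [hasDescent_zero_succ (p := p) t (by omega : 1 ≤ q + 1)
    (by omega : i < 2 * (q + 1) - 1)]

theorem sum_range_ite_lt {n h : ℕ} (hn : h ≤ n) :
    ∑ c ∈ range n, (if c < h then 1 else 0) = h := by
  rw [← card_filter]
  convert card_range h using 2
  ext c
  simp only [mem_filter, mem_range]
  omega

theorem sum_range_ite_sub_lt {p d : ℕ} (hd : d < p) :
    ∑ c ∈ range p, (if p - 1 - c < d then 1 else 0) = d := by
  rw [sum_range_reflect (fun c => if c < d then 1 else 0) p]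
  exact sum_range_ite_lt hd.le

theorem Mnum_zero_succ {h r : ℕ} (hr : 1 ≤ r) :
    Mnum (2 * h + 1) 0 (r + 1) 0 = (2 * h + 1) * Mnum (2 * h + 1) 0 r 0 +
      ∑ N ∈ pathFinset (2 * h + 1) 0 r 0,
        ((if 2 ≤ r then tDig (2 * h + 1) N 0 else 0) + h) := by
  have hp : 0 < 2 * h + 1 := by omega
  unfold Mnum
  rw [sum_pathFinset_succ hp hr, mul_sum, ← sum_add_distrib]
  refine sum_congr rfl fun N _ => ?_
  have hstep : ∀ c ∈ range (2 * h + 1),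
      desNum (2 * h + 1) 0 (r + 1) (tDig (2 * h + 1) (c + (2 * h + 1) * N)) =
        desNum (2 * h + 1) 0 r (tDig (2 * h + 1) N) +
        (if 2 ≤ r ∧ 2 * h + 1 - 1 - c < tDig (2 * h + 1) N 0 then 1 else 0) +
        (if c < h then 1 else 0) := by
    intro c hc
    rw [mem_range] at hc
    have hiff : c < 2 * h + 1 - 1 - c ↔ c < h := by omega
    rw [desNum_zero_succ _ hr, tDig_zero_add_mul hc, tDig_succ_add_mul hc N 0]
    simp only [tDig_succ_add_mul hc, hiff]
  rw [sum_congr rfl hstep, sum_add_distrib, sum_add_distrib, sum_const, card_range,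
    smul_eq_mul, sum_range_ite_lt (by omega), add_assoc]
  by_cases h2 : 2 ≤ r
  · simp only [h2, true_and, if_true, sum_range_ite_sub_lt (tDig_lt hp N 0)]
  · simp [h2]

theorem sum_tDig_zero {h : ℕ} (hh : 1 ≤ h) (r : ℕ) :
    ∑ N ∈ pathFinset (2 * h + 1) 0 (r + 2) 0, tDig (2 * h + 1) N 0 =
      2 * h * (2 * h + 1) ^ r * ((2 * h + 1) * h) := by
  have hsum : ∑ c ∈ range (2 * h + 1), c = (2 * h + 1) * h := by
    have := sum_range_id_mul_two (2 * h + 1)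
    rw [Nat.add_sub_cancel] at this
    linarith
  rw [sum_pathFinset_succ (by omega) (by omega)]
  have hinner : ∀ N, ∑ c ∈ range (2 * h + 1), tDig (2 * h + 1) (c + (2 * h + 1) * N) 0 =
      (2 * h + 1) * h := fun N => by
    rw [← hsum]
    exact sum_congr rfl fun c hc => tDig_zero_add_mul (mem_range.1 hc) N
  simp only [hinner, sum_const, smul_eq_mul, card_pathFinset_zero (by omega : 2 ≤ 2 * h + 1),
    Nat.add_sub_cancel]

theorem Mnum_zero_one {h : ℕ} (hh : 1 ≤ h) : Mnum (2 * h + 1) 0 1 0 = h := by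
  unfold Mnum
  rw [pathFinset_zero_one (by omega), Nat.add_sub_cancel]
  refine Eq.trans (sum_congr rfl fun N hN => ?_) (sum_range_ite_lt (by omega : h ≤ 2 * h))
  rw [mem_range] at hN
  have hdig : tDig (2 * h + 1) N 0 = N := by
    simp [tDig, Nat.mod_eq_of_lt (by omega : N < 2 * h + 1)]
  unfold desNum
  rw [card_filter, Nat.mul_one, sum_range_one]
  simp [HasDescent, hdig]

theorem Mnum_zero_add_two {h : ℕ} (hh : 1 ≤ h) (n : ℕ) :
    Mnum (2 * h + 1) 0 (n + 2) 0 =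
      h * ((2 * h + 1) ^ (n + 1) + (2 * n + 1) * (2 * h) * (2 * h + 1) ^ n) := by
  induction n with
  | zero =>
    rw [Mnum_zero_succ le_rfl, Mnum_zero_one hh, pathFinset_zero_one (by omega)]
    simp
    ring
  | succ n ih =>
    rw [Mnum_zero_succ (by omega), ih, sum_add_distrib]
    simp only [show 2 ≤ n + 1 + 1 by omega, if_true, sum_const, smul_eq_mul,
      card_pathFinset_zero (by omega : 2 ≤ 2 * h + 1), sum_tDig_zero hh, Nat.add_sub_cancel]
    ring

end Bratteli

open Bratteli
/-- closed formula for the `p^{(0)}`-Fibonacci numbers. -/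
theorem p0_fibonacci (p : ℕ) (hp : Nat.Prime p) (hodd : Odd p) :
    Mnum p 0 1 0 = (p - 1) / 2 ∧
    ∀ s : ℕ, 2 ≤ s →
      (Mnum p 0 s 0 : ℤ) = (((p - 1) / 2 : ℕ) : ℤ) *
        (2 * ((s : ℤ) - 1) * (p : ℤ) ^ (s - 1) - (2 * (s : ℤ) - 3) * (p : ℤ) ^ (s - 2)) := by
  obtain ⟨h, rfl⟩ := hodd
  have hh : 1 ≤ h := by have := hp.two_le; omega
  rw [show (2 * h + 1 - 1) / 2 = h by omega]
  refine ⟨Mnum_zero_one hh, fun s hs => ?_⟩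
  obtain ⟨n, rfl⟩ : ∃ n, s = n + 2 := ⟨s - 2, by omega⟩
  rw [Mnum_zero_add_two hh, show n + 2 - 1 = n + 1 by omega, Nat.add_sub_cancel]
  push_cast
  ring
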